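/- Let d ≥ 1 be an integer and 0 < α < min(2,d). Then the function Ψ_{α,d} is strictly decreasing on the interval (−α, (d−α)/2]; that is, for all σ₁, σ₂ with −α < σ₁ < σ₂ ≤ (d−α)/2 one has Ψ_{α,d}(σ₂) < Ψ_{α,d}(σ₁). -/

import Mathlib

open Real

/-- `Ψ_{α,d}(σ) = -2^α Γ((σ+α)/2) Γ((d-σ)/2) / (Γ((d-σ-α)/2) Γ(σ/2))` for `σ ≠ 0`,
and `Ψ_{α,d}(0) = 0`. -/
noncomputable def Psi (α d σ : ℝ) : ℝ :=
  if σ = 0 then 0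
  else -(2 ^ α) * (Real.Gamma ((σ + α) / 2) * Real.Gamma ((d - σ) / 2)) /
    (Real.Gamma ((d - σ - α) / 2) * Real.Gamma (σ / 2))

/-- The product of two terms of Euler's sequence for the Gamma function. -/
theorem GammaSeq_mul_GammaSeq (x y : ℝ) {n : ℕ} (hn : 0 < n) :
    Real.GammaSeq x n * Real.GammaSeq y n =
      (n : ℝ) ^ (x + y) * (n.factorial : ℝ) ^ 2 /
        ∏ j ∈ Finset.range (n + 1), (x + j) * (y + j) := by
  rw [Real.GammaSeq, Real.GammaSeq, div_mul_div_comm, ← Finset.prod_mul_distrib,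
    Real.rpow_add (by exact_mod_cast hn)]
  ring

/-- Log-convexity of the Gamma function in multiplicative form: for two pairs of positive numbers
with the same sum, the pair with the larger product has the smaller product of Gamma values. -/
theorem Gamma_mul_Gamma_le_of_add_eq {p q u v : ℝ} (hu : 0 < u) (hv : 0 < v)
    (hadd : p + q = u + v) (hmul : u * v ≤ p * q) :
    Real.Gamma p * Real.Gamma q ≤ Real.Gamma u * Real.Gamma v := by
  refine le_of_tendsto_of_tendsto
    ((Real.GammaSeq_tendsto_Gamma p).mul (Real.GammaSeq_tendsto_Gamma q))
    ((Real.GammaSeq_tendsto_Gamma u).mul (Real.GammaSeq_tendsto_Gamma v)) ?_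
  filter_upwards [Filter.eventually_gt_atTop 0] with n hn
  rw [GammaSeq_mul_GammaSeq _ _ hn, GammaSeq_mul_GammaSeq _ _ hn, hadd]
  refine div_le_div_of_nonneg_left (by positivity) (Finset.prod_pos fun j _ => by positivity)
    (Finset.prod_le_prod (fun j _ => by positivity) fun j _ => ?_)
  linear_combination hmul - (j : ℝ) * hadd

/-- Log-concavity of `x ↦ Γ(x + a) / Γ(x)`, with denominators cleared. -/
theorem Gamma_add_mul_Gamma_add_le {a p q u v : ℝ} (ha : 0 ≤ a) (hp : 0 < p) (hq : 0 < q)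
    (hu : 0 < u) (hv : 0 < v) (hadd : p + q = u + v) (hmul : u * v ≤ p * q) :
    Real.Gamma (u + a) * Real.Gamma (v + a) * (Real.Gamma p * Real.Gamma q) ≤
      Real.Gamma (p + a) * Real.Gamma (q + a) * (Real.Gamma u * Real.Gamma v) := by
  have tendsto (x y z w : ℝ) := ((Real.GammaSeq_tendsto_Gamma x).mul
    (Real.GammaSeq_tendsto_Gamma y)).mul
    ((Real.GammaSeq_tendsto_Gamma z).mul (Real.GammaSeq_tendsto_Gamma w))
  refine le_of_tendsto_of_tendsto (tendsto _ _ _ _) (tendsto _ _ _ _) ?_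
  filter_upwards [Filter.eventually_gt_atTop 0] with n hn
  simp only [GammaSeq_mul_GammaSeq _ _ hn]
  rw [div_mul_div_comm, div_mul_div_comm, ← Finset.prod_mul_distrib, ← Finset.prod_mul_distrib,
    hadd, show p + a + (q + a) = u + a + (v + a) by linear_combination hadd]
  refine div_le_div_of_nonneg_left (by positivity) (Finset.prod_pos fun j _ => by positivity)
    (Finset.prod_le_prod (fun j _ => by positivity) fun j _ => ?_)
  have hj : (0 : ℝ) ≤ a * (u + v + a + 2 * j) := by positivity
  obtain rfl : q = u + v - p := by linear_combination hadd
  nlinarith [mul_nonneg hj (sub_nonneg.2 hmul)]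

/-- Strict log-concavity of `x ↦ Γ(x + a) / Γ(x)`, with denominators cleared. -/
theorem Gamma_add_mul_Gamma_add_lt {a p q u v : ℝ} (ha : 0 < a) (hp : 0 < p) (hq : 0 < q)
    (hu : 0 < u) (hv : 0 < v) (hadd : p + q = u + v) (hmul : u * v < p * q) :
    Real.Gamma (u + a) * Real.Gamma (v + a) * (Real.Gamma p * Real.Gamma q) <
      Real.Gamma (p + a) * Real.Gamma (q + a) * (Real.Gamma u * Real.Gamma v) := by
  have weak := Gamma_add_mul_Gamma_add_le (a := a) (p := p + 1) (q := q + 1) (u := u + 1)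
    (v := v + 1) ha.le (by positivity) (by positivity) (by positivity) (by positivity)
    (by linear_combination hadd) (by linear_combination hmul - hadd)
  simp only [add_right_comm _ (1 : ℝ) a] at weak
  rw [Real.Gamma_add_one hp.ne', Real.Gamma_add_one hq.ne', Real.Gamma_add_one hu.ne',
    Real.Gamma_add_one hv.ne', Real.Gamma_add_one (add_pos hp ha).ne',
    Real.Gamma_add_one (add_pos hq ha).ne', Real.Gamma_add_one (add_pos hu ha).ne',
    Real.Gamma_add_one (add_pos hv ha).ne'] at weak
  have coeff : (p + a) * (q + a) * (u * v) < (u + a) * (v + a) * (p * q) := by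
    obtain rfl : q = u + v - p := by linear_combination hadd
    nlinarith [mul_pos (show 0 < a * (u + v + a) by positivity) (sub_pos.2 hmul)]
  have hR : 0 < Real.Gamma (p + a) * Real.Gamma (q + a) * (Real.Gamma u * Real.Gamma v) := by
    have := Real.Gamma_pos_of_pos (add_pos hp ha)
    have := Real.Gamma_pos_of_pos (add_pos hq ha)
    have := Real.Gamma_pos_of_pos hu
    have := Real.Gamma_pos_of_pos hv
    positivity
  refine lt_of_mul_lt_mul_left (a := (u + a) * (v + a) * (p * q)) ?_ (by positivity)
  linear_combination weak + mul_lt_mul_of_pos_right coeff hR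

/-- The expression `Γ(s+a) Γ(D-s) / (Γ(D-a-s) Γ(s))`, with `Γ(s) = Γ(s+1) / s` inserted so that it
extends continuously by `0` to `s = 0`. -/
noncomputable def gammaQuotient (a D s : ℝ) : ℝ :=
  s * (Real.Gamma (s + a) * Real.Gamma (D - s)) / (Real.Gamma (D - a - s) * Real.Gamma (s + 1))

theorem Psi_eq_neg_mul_gammaQuotient (α d σ : ℝ) :
    Psi α d σ = -(2 ^ α) * gammaQuotient (α / 2) (d / 2) (σ / 2) := by
  rcases eq_or_ne σ 0 with rfl | hσ
  · simp [Psi, gammaQuotient]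
  · have hσ2 : σ / 2 ≠ 0 := by positivity
    rw [Psi, if_neg hσ, gammaQuotient, Real.Gamma_add_one hσ2, mul_left_comm _ (σ / 2),
      mul_div_mul_left _ _ hσ2, mul_div_assoc]
    ring_nf

theorem gammaQuotient_factor_pos {a D s : ℝ} (ha1 : a < 1) (hs : -a < s)
    (hsD : s < D - a) (hsD' : s < D) :
    0 < Real.Gamma (s + a) * Real.Gamma (D - s) ∧
      0 < Real.Gamma (D - a - s) * Real.Gamma (s + 1) :=
  ⟨mul_pos (Real.Gamma_pos_of_pos (by linarith)) (Real.Gamma_pos_of_pos (by linarith)),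
    mul_pos (Real.Gamma_pos_of_pos (by linarith)) (Real.Gamma_pos_of_pos (by linarith))⟩

theorem gammaQuotient_lt_of_neg {a D s t : ℝ} (ha : 0 < a) (ha1 : a < 1) (haD : a < D)
    (hs : -a < s) (hst : s < t) (ht : t < 0) :
    gammaQuotient a D s < gammaQuotient a D t := by
  obtain ⟨hs1, hs2⟩ := gammaQuotient_factor_pos (D := D) ha1 hs (by linarith) (by linarith)
  obtain ⟨ht1, ht2⟩ := gammaQuotient_factor_pos (D := D) (s := t) ha1 (by linarith)
    (by linarith) (by linarith)
  have left : Real.Gamma (t + a) * Real.Gamma (s + 1) ≤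
      Real.Gamma (s + a) * Real.Gamma (t + 1) :=
    Gamma_mul_Gamma_le_of_add_eq (by linarith) (by linarith) (by ring)
      (by nlinarith [mul_pos (sub_pos.2 ha1) (sub_pos.2 hst)])
  have right : Real.Gamma (D - t) * Real.Gamma (D - a - s) ≤
      Real.Gamma (D - s) * Real.Gamma (D - a - t) :=
    Gamma_mul_Gamma_le_of_add_eq (by linarith) (by linarith) (by ring)
      (by nlinarith [mul_pos ha (sub_pos.2 hst)])
  have prod := mul_le_mul left right
    (mul_nonneg (Real.Gamma_nonneg_of_nonneg (by linarith))
      (Real.Gamma_nonneg_of_nonneg (by linarith)))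
    (mul_nonneg (Real.Gamma_nonneg_of_nonneg (by linarith))
      (Real.Gamma_nonneg_of_nonneg (by linarith)))
  rw [gammaQuotient, gammaQuotient, div_lt_div_iff₀ hs2 ht2]
  have h1 := mul_le_mul_of_nonneg_left prod (neg_nonneg.2 ht.le)
  have h2 := mul_pos (sub_pos.2 hst) (mul_pos hs1 ht2)
  linear_combination h1 + h2

theorem gammaQuotient_lt_of_pos {a D s t : ℝ} (ha : 0 < a) (ha1 : a < 1)
    (hs : 0 < s) (hst : s < t) (ht : t ≤ (D - a) / 2) :
    gammaQuotient a D s < gammaQuotient a D t := by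
  obtain ⟨-, hs2⟩ := gammaQuotient_factor_pos (D := D) (s := s) ha1 (by linarith)
    (by linarith) (by linarith)
  obtain ⟨-, ht2⟩ := gammaQuotient_factor_pos (D := D) (s := t) ha1 (by linarith)
    (by linarith) (by linarith)
  have key := Gamma_add_mul_Gamma_add_lt (p := t) (q := D - a - t) (u := s) (v := D - a - s) ha
    (by linarith) (by linarith) hs (by linarith) (by ring)
    (by nlinarith [mul_pos (sub_pos.2 hst) (show 0 < D - a - s - t by linarith)])
  rw [show D - a - t + a = D - t by ring, show D - a - s + a = D - s by ring] at key
  rw [gammaQuotient, gammaQuotient, div_lt_div_iff₀ hs2 ht2, Real.Gamma_add_one hs.ne',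
    Real.Gamma_add_one (hs.trans hst).ne']
  linear_combination mul_lt_mul_of_pos_left key (mul_pos hs (hs.trans hst))

theorem gammaQuotient_strictMonoOn {a D : ℝ} (ha : 0 < a) (ha1 : a < 1) (haD : a < D) :
    StrictMonoOn (gammaQuotient a D) (Set.Ioc (-a) ((D - a) / 2)) := by
  rintro s ⟨hs, hsD⟩ t ⟨ht, htD⟩ hst
  rcases lt_or_ge 0 s with hs0 | hs0
  · exact gammaQuotient_lt_of_pos ha ha1 hs0 hst htD
  rcases lt_or_ge t 0 with ht0 | ht0
  · exact gammaQuotient_lt_of_neg ha ha1 haD hs hst ht0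
  obtain ⟨hs1, hs2⟩ := gammaQuotient_factor_pos (D := D) ha1 hs (by linarith) (by linarith)
  obtain ⟨ht1, ht2⟩ := gammaQuotient_factor_pos (D := D) ha1 ht (by linarith) (by linarith)
  rw [gammaQuotient, gammaQuotient]
  rcases hs0.lt_or_eq with hs0 | rfl
  · exact (div_neg_of_neg_of_pos (mul_neg_of_neg_of_pos hs0 hs1) hs2).trans_le
      (div_nonneg (mul_nonneg ht0 ht1.le) ht2.le)
  · rw [zero_mul, zero_div]
    exact div_pos (mul_pos hst ht1) ht2

/-- For an integer `d ≥ 1` and `0 < α < min(2,d)`, the function `Ψ_{α,d}` is strictly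
decreasing on the interval `(-α, (d-α)/2]`. -/
theorem psi_strictAntiOn (d : ℕ) (hd : 1 ≤ d) (α : ℝ) (hα : 0 < α)
    (hα2 : α < min 2 (d : ℝ)) :
    ∀ σ₁ σ₂ : ℝ, -α < σ₁ → σ₁ < σ₂ → σ₂ ≤ ((d : ℝ) - α) / 2 →
      Psi α d σ₂ < Psi α d σ₁ := by
  intro σ₁ σ₂ h₁ h₁₂ h₂
  obtain ⟨hα2, hαd⟩ := lt_min_iff.1 hα2
  have key : gammaQuotient (α / 2) (d / 2) (σ₁ / 2) < gammaQuotient (α / 2) (d / 2) (σ₂ / 2) :=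
    gammaQuotient_strictMonoOn (by linarith) (by linarith) (by linarith)
      ⟨by linarith, by linarith⟩ ⟨by linarith, by linarith⟩ (by linarith)
  rw [Psi_eq_neg_mul_gammaQuotient, Psi_eq_neg_mul_gammaQuotient]
  exact mul_lt_mul_of_neg_left key (neg_lt_zero.2 (by positivity))
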